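/- (Local part of Sublemma 5.3: real-analytic solvability of first-order systems with complex-valued analytic coefficients.) Let m, N ≥ 1, d ≥ 0, and (t₀, x₀) ∈ ℝ × ℝ^m, and let W be an open neighborhood of (t₀,x₀) in ℝ^{1+m}. Let A = (A¹,…,A^m) : W → ℂ^m be real-analytic, and for each multi-index β ∈ ℕ^N with |β| ≤ d let c_β : W → ℂ^N be real-analytic; set P(t,x,u) = Σ_{|β| ≤ d} c_β(t,x)·u^β for u ∈ ℂ^N (u^β = (u¹)^{β₁}⋯(u^N)^{β_N}). Let V be a real-analytic ℂ^N-valued map on an open neighborhood of x₀ in ℝ^m. Then there exist ε > 0, an open neighborhood Ω of x₀ with (t₀−ε, t₀+ε) × Ω ⊆ W, and a real-analytic map U : (t₀−ε, t₀+ε) × Ω → ℂ^N such that ∂U/∂t(t,x) + Σ_{i=1}^m Aⁱ(t,x)·∂U/∂xⁱ(t,x) = P(t, x, U(t,x)) for all (t,x) and U(t₀, x) = V(x) for all x ∈ Ω. Moreover, if U₁ and U₂ are real-analytic solutions of this equation on an open neighborhood of (t₀,x₀) with U₁(t₀,·) = U₂(t₀,·) on a neighborhood of x₀, then U₁ = U₂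 on some neighborhood of (t₀,x₀). -/

import Mathlib

noncomputable section

/-- The finite set of multi-indices `β ∈ ℕ^N` with `|β| = Σ_j β_j ≤ d`. -/
def multiIdxSet (N d : ℕ) : Finset (Fin N → ℕ) :=
  (Fintype.piFinset fun _ : Fin N => Finset.range (d + 1)).filter fun β => ∑ j, β j ≤ d

/-- `P(t,x,u) = Σ_{|β| ≤ d} c_β(t,x)·u^β`, where `u^β = (u¹)^{β₁}⋯(u^N)^{β_N}`. -/
def polyP {m N : ℕ} (d : ℕ)
    (c : (Fin N → ℕ) → (ℝ × (Fin m → ℝ)) → (Fin N → ℂ))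
    (p : ℝ × (Fin m → ℝ)) (u : Fin N → ℂ) : Fin N → ℂ :=
  fun k => ∑ β ∈ multiIdxSet N d, c β p k * ∏ j, u j ^ β j

/-- `U` solves the first-order system
`∂U/∂t(t,x) + Σ_i Aⁱ(t,x)·∂U/∂xⁱ(t,x) = P(t,x,U(t,x))` on the set `s`. -/
def SolvesPDE {m N : ℕ} (A : (ℝ × (Fin m → ℝ)) → (Fin m → ℂ)) (d : ℕ)
    (c : (Fin N → ℕ) → (ℝ × (Fin m → ℝ)) → (Fin N → ℂ))
    (U : ℝ × (Fin m → ℝ) → (Fin N → ℂ)) (s : Set (ℝ × (Fin m → ℝ))) : Prop :=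
  ∀ p ∈ s,
    fderiv ℝ U p ((1 : ℝ), (0 : Fin m → ℝ))
      + ∑ i, A p i • fderiv ℝ U p ((0 : ℝ), Pi.single i (1 : ℝ))
      = polyP d c p (U p)

namespace CauchyKovalevskaya

open scoped NNReal ENNReal
open MvPowerSeries Finset

section WeightedNorm

variable {ι : Type*}

/-- The weighted `ℓ¹` norm `∑ₑ ‖uₑ‖ w(e)` of a power series, with values in `[0, ∞]`. -/
def wnorm (w : (ι →₀ ℕ) → ℝ≥0) (u : MvPowerSeries ι ℂ) : ℝ≥0∞ :=
  ∑' e, ‖coeff e u‖ₑ * w e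

lemma wnorm_zero (w : (ι →₀ ℕ) → ℝ≥0) : wnorm w 0 = 0 := by simp [wnorm]

lemma wnorm_add_le (w : (ι →₀ ℕ) → ℝ≥0) (u v : MvPowerSeries ι ℂ) :
    wnorm w (u + v) ≤ wnorm w u + wnorm w v := by
  unfold wnorm
  rw [← ENNReal.tsum_add]
  refine ENNReal.tsum_le_tsum fun e => ?_
  rw [← add_mul, map_add]
  gcongr
  exact enorm_add_le _ _

lemma wnorm_neg (w : (ι →₀ ℕ) → ℝ≥0) (u : MvPowerSeries ι ℂ) :
    wnorm w (-u) = wnorm w u := by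
  simp [wnorm]

lemma wnorm_sub_le (w : (ι →₀ ℕ) → ℝ≥0) (u v : MvPowerSeries ι ℂ) :
    wnorm w (u - v) ≤ wnorm w u + wnorm w v := by
  rw [sub_eq_add_neg, ← wnorm_neg w v]
  exact wnorm_add_le w u (-v)

lemma wnorm_sum_le {α : Type*} (w : (ι →₀ ℕ) → ℝ≥0) (s : Finset α) (u : α → MvPowerSeries ι ℂ) :
    wnorm w (∑ a ∈ s, u a) ≤ ∑ a ∈ s, wnorm w (u a) :=
  Finset.le_sum_of_subadditive _ (wnorm_zero w).le (wnorm_add_le w) s u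

lemma wnorm_mono {w w' : (ι →₀ ℕ) → ℝ≥0} (h : ∀ e, w e ≤ w' e) (u : MvPowerSeries ι ℂ) :
    wnorm w u ≤ wnorm w' u :=
  ENNReal.tsum_le_tsum fun e => by gcongr; exact h e

lemma wnorm_mul_le [DecidableEq ι] {w₁ w₂ w₃ : (ι →₀ ℕ) → ℝ≥0}
    (h : ∀ e e', w₃ (e + e') ≤ w₁ e * w₂ e') (u v : MvPowerSeries ι ℂ) :
    wnorm w₃ (u * v) ≤ wnorm w₁ u * wnorm w₂ v := by
  have key : wnorm w₁ u * wnorm w₂ v = ∑' e, ∑ p ∈ antidiagonal e,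
      (‖coeff p.1 u‖ₑ * w₁ p.1) * (‖coeff p.2 v‖ₑ * w₂ p.2) := by
    unfold wnorm
    simp_rw [← ENNReal.tsum_mul_right, ← ENNReal.tsum_mul_left]
    rw [← ENNReal.tsum_prod, ← HasAntidiagonal.sigmaAntidiagonalEquivProd.tsum_eq,
      ENNReal.tsum_sigma']
    refine tsum_congr fun e => ?_
    rw [tsum_fintype, ← Finset.sum_coe_sort (antidiagonal e)]
    rfl
  rw [key]
  refine ENNReal.tsum_le_tsum fun e => ?_
  rw [coeff_mul]
  calc _ ≤ (∑ p ∈ antidiagonal e, ‖coeff p.1 u * coeff p.2 v‖ₑ) * w₃ e := by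
        gcongr
        exact enorm_sum_le _ _
    _ ≤ _ := by
        rw [Finset.sum_mul]
        refine Finset.sum_le_sum fun p hp => ?_
        rw [enorm_mul, mul_mul_mul_comm]
        gcongr
        rw [← mem_antidiagonal.1 hp]
        exact_mod_cast h p.1 p.2

lemma wnorm_one (w : (ι →₀ ℕ) → ℝ≥0) (h0 : w 0 = 1) : wnorm w 1 = 1 := by
  classical
  unfold wnorm
  rw [tsum_eq_single 0]
  · simp [h0]
  · intro e he
    simp [coeff_one, he]

lemma wnorm_prod_le [DecidableEq ι] {α : Type*} {w : (ι →₀ ℕ) → ℝ≥0} (h0 : w 0 = 1)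
    (h : ∀ e e', w (e + e') ≤ w e * w e') (s : Finset α) (u : α → MvPowerSeries ι ℂ) :
    wnorm w (∏ a ∈ s, u a) ≤ ∏ a ∈ s, wnorm w (u a) :=
  Finset.le_prod_of_submultiplicative _ (wnorm_one w h0).le (wnorm_mul_le h) s u

lemma wnorm_pow_le [DecidableEq ι] {w : (ι →₀ ℕ) → ℝ≥0} (h0 : w 0 = 1)
    (h : ∀ e e', w (e + e') ≤ w e * w e') (u : MvPowerSeries ι ℂ) (n : ℕ) :
    wnorm w (u ^ n) ≤ wnorm w u ^ n := by
  simpa using wnorm_prod_le h0 h (Finset.range n) fun _ => u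

end WeightedNorm

section Weights

variable {ι : Type*}

/-- The geometric weight `ρ ^ |e|`. -/
def geo (ρ : ℝ≥0) (e : ι →₀ ℕ) : ℝ≥0 := ρ ^ e.degree

/-- The weight `τ ^ k r ^ n / binom(n, k)`, where `n = |e|` and `k = e t`. -/
def binomWeight (t : ι) (τ r : ℝ≥0) (e : ι →₀ ℕ) : ℝ≥0 :=
  τ ^ e t * r ^ e.degree / (e.degree.choose (e t))

/-- The weight for which `antideriv t` is bounded into the weight `binomWeight t τ r`. -/
def binomWeight' (t : ι) (τ r : ℝ≥0) (e : ι →₀ ℕ) : ℝ≥0 :=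
  τ ^ (e t + 1) * r ^ (e.degree + 1) / ((e.degree + 1) * e.degree.choose (e t))

lemma binomWeight_zero (t : ι) (τ r : ℝ≥0) : binomWeight t τ r 0 = 1 := by
  simp [binomWeight]

lemma choose_degree_pos (t : ι) (e : ι →₀ ℕ) : (0 : ℝ≥0) < (e.degree.choose (e t) : ℕ) := by
  exact_mod_cast Nat.choose_pos (Finsupp.le_degree t e)

lemma choose_mul_choose_le (n₁ n₂ k₁ k₂ : ℕ) :
    n₁.choose k₁ * n₂.choose k₂ ≤ (n₁ + n₂).choose (k₁ + k₂) := by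
  rw [Nat.add_choose_eq]
  exact Finset.single_le_sum (f := fun p : ℕ × ℕ => n₁.choose p.1 * n₂.choose p.2)
    (fun _ _ => Nat.zero_le _) (a := (k₁, k₂)) (by simp)

lemma binomWeight_add_le (t : ι) (τ r : ℝ≥0) (e e' : ι →₀ ℕ) :
    binomWeight t τ r (e + e') ≤ binomWeight t τ r e * binomWeight t τ r e' := by
  have h1 := choose_degree_pos t e
  have h2 := choose_degree_pos t e'
  simp only [binomWeight, map_add, Finsupp.add_apply]
  rw [div_mul_div_comm]
  have h3 : ((e.degree.choose (e t) : ℕ) * (e'.degree.choose (e' t) : ℕ) : ℝ≥0)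
      ≤ ((e.degree + e'.degree).choose (e t + e' t) : ℕ) := by
    exact_mod_cast choose_mul_choose_le _ _ _ _
  rw [show τ ^ (e t + e' t) * r ^ (e.degree + e'.degree)
    = τ ^ e t * r ^ e.degree * (τ ^ e' t * r ^ e'.degree) by ring]
  gcongr

lemma binomWeight'_add_le (t : ι) (τ r : ℝ≥0) (e e' : ι →₀ ℕ) :
    binomWeight' t τ r (e + e') ≤ binomWeight t τ r e * binomWeight' t τ r e' := by
  have h1 := choose_degree_pos t e
  have h2 := choose_degree_pos t e'
  simp only [binomWeight, binomWeight', map_add, Finsupp.add_apply]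
  rw [div_mul_div_comm]
  have h3 : ((e.degree.choose (e t) : ℕ) * ((e'.degree + 1) * (e'.degree.choose (e' t) : ℕ)) : ℝ≥0)
      ≤ ((e.degree + e'.degree : ℕ) + 1) * ((e.degree + e'.degree).choose (e t + e' t) : ℕ) := by
    have := choose_mul_choose_le e.degree e'.degree (e t) (e' t)
    norm_cast
    calc _ = (e'.degree + 1) * (e.degree.choose (e t) * e'.degree.choose (e' t)) := by ring
      _ ≤ _ := Nat.mul_le_mul (by omega) this
  rw [show τ ^ (e t + e' t + 1) * r ^ (e.degree + e'.degree + 1)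
    = τ ^ e t * r ^ e.degree * (τ ^ (e' t + 1) * r ^ (e'.degree + 1)) by ring]
  push_cast at h3 ⊢
  gcongr

lemma binomWeight'_le (t : ι) (τ : ℝ≥0) {r : ℝ≥0} (hr : r ≤ 1) (e : ι →₀ ℕ) :
    binomWeight' t τ r e ≤ τ * binomWeight t τ r e := by
  have h1 := choose_degree_pos t e
  simp only [binomWeight, binomWeight']
  rw [mul_div_assoc', ← mul_assoc, ← pow_succ']
  have h2 : (1 : ℝ≥0) ≤ e.degree + 1 := by simp
  gcongr ?_ * ?_ / ?_
  · exact le_rfl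
  · exact pow_le_pow_of_le_one zero_le hr (Nat.le_succ _)
  · exact le_mul_of_one_le_left zero_le h2

lemma mul_binomWeight'_le {t i : ι} (hti : i ≠ t) (τ r : ℝ≥0) (e : ι →₀ ℕ) :
    (e i + 1) * binomWeight' t τ r e ≤ τ * binomWeight t τ r (e + Finsupp.single i 1) := by
  have h1 := choose_degree_pos t e
  have h2 := choose_degree_pos t (e + Finsupp.single i 1)
  have hle : e i + e t ≤ e.degree := by
    classical
    have : ∑ j ∈ ({i, t} : Finset ι), e j ≤ e.degree := by
      rw [Finsupp.degree_apply, Finset.sum_subset (s₂ := e.support ∪ {i, t})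
        (Finset.subset_union_left) (by simp)]
      exact Finset.sum_le_sum_of_subset Finset.subset_union_right
    simpa [Finset.sum_pair hti] using this
  simp only [map_add, Finsupp.add_apply, Finsupp.single_eq_of_ne' hti, Finsupp.degree_single,
    add_zero, binomWeight, binomWeight'] at h2 ⊢
  rw [mul_div_assoc', mul_div_assoc', div_le_div_iff₀ (by positivity) h2]
  have h3 : (e i + 1 : ℝ≥0) * ((e.degree + 1).choose (e t) : ℕ)
      ≤ (e.degree + 1) * (e.degree.choose (e t) : ℕ) := by
    norm_cast
    have := Nat.choose_mul_succ_eq e.degree (e t)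
    rw [mul_comm (e.degree + 1), this, mul_comm]
    exact Nat.mul_le_mul_left _ (by omega)
  calc _ = τ ^ (e t + 1) * r ^ (e.degree + 1) * ((e i + 1) * ((e.degree + 1).choose (e t) : ℕ)) := by
        ring
    _ ≤ τ ^ (e t + 1) * r ^ (e.degree + 1) * ((e.degree + 1) * (e.degree.choose (e t) : ℕ)) := by
        gcongr
    _ = _ := by ring

lemma geo_le_binomWeight (t : ι) {τ : ℝ≥0} (hτ : τ ≤ 1) (r : ℝ≥0) (e : ι →₀ ℕ) :
    geo (τ * r / 2) e ≤ binomWeight t τ r e := by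
  have h1 := choose_degree_pos t e
  simp only [geo, binomWeight, div_pow, mul_pow]
  gcongr ?_ * _ / ?_
  · exact pow_le_pow_of_le_one zero_le hτ (Finsupp.le_degree t e)
  · exact_mod_cast Nat.choose_le_two_pow _ _

lemma binomWeight_le_geo (t : ι) {τ : ℝ≥0} (hτ : τ ≤ 1) (r : ℝ≥0) (e : ι →₀ ℕ) :
    binomWeight t τ r e ≤ geo r e := by
  have h1 := choose_degree_pos t e
  simp only [geo, binomWeight]
  have h2 : (1 : ℝ≥0) ≤ (e.degree.choose (e t) : ℕ) := by
    exact_mod_cast Nat.choose_pos (Finsupp.le_degree t e)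
  calc _ ≤ 1 * r ^ e.degree / 1 := by
        gcongr
        exact pow_le_one₀ zero_le hτ
    _ = _ := by simp

end Weights

section Antiderivative

variable {ι : Type*}

/-- The formal antiderivative with respect to the variable `t`, vanishing at `t = 0`. -/
def antideriv (t : ι) (u : MvPowerSeries ι ℂ) : MvPowerSeries ι ℂ :=
  fun e => coeff (e - Finsupp.single t 1) u / e t

lemma coeff_antideriv (t : ι) (u : MvPowerSeries ι ℂ) (e : ι →₀ ℕ) :
    coeff e (antideriv t u) = coeff (e - Finsupp.single t 1) u / e t := rfl

lemma coeff_antideriv_add (t : ι) (u : MvPowerSeries ι ℂ) (e : ι →₀ ℕ) :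
    coeff (e + Finsupp.single t 1) (antideriv t u) = coeff e u / (e t + 1) := by
  simp [coeff_antideriv]

lemma pderiv_antideriv (t : ι) (u : MvPowerSeries ι ℂ) : pderiv ℂ t (antideriv t u) = u := by
  ext e
  rw [coeff_pderiv, coeff_antideriv_add]
  exact div_mul_cancel₀ _ (by exact_mod_cast Nat.succ_ne_zero (e t))

lemma enorm_natCast_add_one (n : ℕ) : ‖(n + 1 : ℂ)‖ₑ = ((n + 1 : ℝ≥0) : ℝ≥0∞) := by
  have h : ‖(n + 1 : ℂ)‖₊ = (n + 1 : ℝ≥0) := by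
    rw [← Nat.cast_succ, Complex.nnnorm_natCast, Nat.cast_succ]
  rw [enorm_eq_nnnorm, h]

lemma wnorm_antideriv_le (t : ι) (τ r : ℝ≥0) (v : MvPowerSeries ι ℂ) :
    wnorm (binomWeight t τ r) (antideriv t v) ≤ wnorm (binomWeight' t τ r) v := by
  unfold wnorm
  rw [← (add_left_injective (Finsupp.single t 1)).tsum_eq]
  · refine ENNReal.tsum_le_tsum fun e => ?_
    have h1 := choose_degree_pos t e
    have h2 := choose_degree_pos t (e + Finsupp.single t 1)
    have h4 : (e t + 1 : ℝ≥0) ≠ 0 := by positivity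
    rw [coeff_antideriv_add, div_eq_mul_inv, enorm_mul,
      enorm_inv (by exact_mod_cast Nat.succ_ne_zero (e t)), enorm_natCast_add_one,
      ← ENNReal.coe_inv h4, mul_assoc, ← ENNReal.coe_mul]
    gcongr
    simp only [map_add, Finsupp.add_apply, Finsupp.single_eq_same, Finsupp.degree_single,
      binomWeight, binomWeight'] at h2 ⊢
    rw [inv_mul_eq_div, div_div, div_le_div_iff₀ (by positivity) (by positivity)]
    have h5 : ((e.degree + 1) * (e.degree.choose (e t) : ℕ) : ℝ≥0)
        = ((e.degree + 1).choose (e t + 1) : ℕ) * (e t + 1) := by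
      exact_mod_cast Nat.add_one_mul_choose_eq _ _
    rw [h5]
  · intro e he
    refine ⟨e - Finsupp.single t 1, ?_⟩
    refine tsub_add_cancel_of_le (Finsupp.single_le_iff.2 (Nat.one_le_iff_ne_zero.2 fun h => he ?_))
    simp [coeff_antideriv, h]

lemma wnorm_antideriv_le_mul (t : ι) (τ : ℝ≥0) {r : ℝ≥0} (hr : r ≤ 1) (v : MvPowerSeries ι ℂ) :
    wnorm (binomWeight t τ r) (antideriv t v) ≤ τ * wnorm (binomWeight t τ r) v := by
  refine (wnorm_antideriv_le t τ r v).trans ?_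
  unfold wnorm
  rw [← ENNReal.tsum_mul_left]
  refine ENNReal.tsum_le_tsum fun e => ?_
  rw [mul_left_comm, ← ENNReal.coe_mul]
  gcongr
  exact binomWeight'_le t τ hr e

lemma wnorm_pderiv_le {t i : ι} (hti : i ≠ t) (τ r : ℝ≥0) (u : MvPowerSeries ι ℂ) :
    wnorm (binomWeight' t τ r) (pderiv ℂ i u) ≤ τ * wnorm (binomWeight t τ r) u := by
  unfold wnorm
  rw [← ENNReal.tsum_mul_left]
  refine le_trans (ENNReal.tsum_le_tsum fun e => ?_)
    (ENNReal.tsum_comp_le_tsum_of_injective (add_left_injective (Finsupp.single i 1)) _)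
  rw [coeff_pderiv, enorm_mul, enorm_natCast_add_one, mul_assoc, mul_left_comm (τ : ℝ≥0∞),
    ← ENNReal.coe_mul, ← ENNReal.coe_mul]
  exact mul_le_mul' le_rfl (ENNReal.coe_le_coe.2 (mul_binomWeight'_le hti τ r e))

lemma wnorm_antideriv_mul_pderiv_le [DecidableEq ι] {t i : ι} (hti : i ≠ t) (τ r : ℝ≥0)
    (a u : MvPowerSeries ι ℂ) :
    wnorm (binomWeight t τ r) (antideriv t (a * pderiv ℂ i u))
      ≤ τ * (wnorm (binomWeight t τ r) a * wnorm (binomWeight t τ r) u) := by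
  refine (wnorm_antideriv_le t τ r _).trans
    ((wnorm_mul_le (binomWeight'_add_le t τ r) a _).trans ?_)
  rw [mul_left_comm]
  gcongr
  exact wnorm_pderiv_le hti τ r u

end Antiderivative

section FixedPoint

variable {ι κ : Type*}

lemma X_pow_succ_dvd_antideriv {t : ι} {n : ℕ} {u : MvPowerSeries ι ℂ}
    (h : (X t : MvPowerSeries ι ℂ) ^ n ∣ u) :
    (X t : MvPowerSeries ι ℂ) ^ (n + 1) ∣ antideriv t u := by
  rw [X_pow_dvd_iff] at h ⊢
  intro e he
  rw [coeff_antideriv]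
  by_cases h0 : e t = 0
  · simp [h0]
  · rw [h, zero_div]
    simp only [Finsupp.tsub_apply, Finsupp.single_eq_same]
    omega

lemma X_pow_dvd_pderiv {t i : ι} (hti : i ≠ t) {n : ℕ} {u : MvPowerSeries ι ℂ}
    (h : (X t : MvPowerSeries ι ℂ) ^ n ∣ u) :
    (X t : MvPowerSeries ι ℂ) ^ n ∣ pderiv ℂ i u := by
  rw [X_pow_dvd_iff] at h ⊢
  intro e he
  rw [coeff_pderiv, h, zero_mul]
  simpa [Finsupp.single_eq_of_ne' hti] using he

lemma antideriv_sub (t : ι) (u v : MvPowerSeries ι ℂ) :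
    antideriv t (u - v) = antideriv t u - antideriv t v := by
  ext e
  simp [coeff_antideriv, sub_div]

/-- A map on tuples of power series that improves the order of agreement in the variable `t` has
at most one fixed point. -/
lemma fixedPoint_unique {t : ι} {T : (κ → MvPowerSeries ι ℂ) → κ → MvPowerSeries ι ℂ}
    (hT : ∀ n u v, (∀ k, (X t : MvPowerSeries ι ℂ) ^ n ∣ u k - v k) →
      ∀ k, (X t : MvPowerSeries ι ℂ) ^ (n + 1) ∣ T u k - T v k)
    {u v : κ → MvPowerSeries ι ℂ} (hu : T u = u) (hv : T v = v) : u = v := by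
  have h : ∀ n k, (X t : MvPowerSeries ι ℂ) ^ n ∣ u k - v k := by
    intro n
    induction n with
    | zero => simp
    | succ n ih => simpa only [hu, hv] using hT n u v ih
  ext k e
  have := X_pow_dvd_iff.1 (h (e t + 1) k) e (Nat.lt_succ_self _)
  rwa [map_sub, sub_eq_zero] at this

/-- A map on tuples of power series that improves the order of agreement in the variable `t` and
preserves a ball for a weighted `ℓ¹` norm has a fixed point in this ball. -/
lemma exists_fixedPoint {t : ι} {T : (κ → MvPowerSeries ι ℂ) → κ → MvPowerSeries ι ℂ}
    (hT : ∀ n u v, (∀ k, (X t : MvPowerSeries ι ℂ) ^ n ∣ u k - v k) →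
      ∀ k, (X t : MvPowerSeries ι ℂ) ^ (n + 1) ∣ T u k - T v k)
    {w : (ι →₀ ℕ) → ℝ≥0} {K : ℝ≥0∞}
    (hb : ∀ u, (∀ k, wnorm w (u k) ≤ K) → ∀ k, wnorm w (T u k) ≤ K) :
    ∃ u, T u = u ∧ ∀ k, wnorm w (u k) ≤ K := by
  let s : ℕ → κ → MvPowerSeries ι ℂ := fun n => T^[n] 0
  have hs : ∀ n, s (n + 1) = T (s n) := fun n => Function.iterate_succ_apply' T n 0
  have hsb : ∀ n k, wnorm w (s n k) ≤ K := by
    intro n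
    induction n with
    | zero => intro k; simp [s, wnorm_zero]
    | succ n ih => rw [hs]; exact hb _ ih
  have h1 : ∀ n k, (X t : MvPowerSeries ι ℂ) ^ n ∣ s (n + 1) k - s n k := by
    intro n
    induction n with
    | zero => simp
    | succ n ih => simpa only [hs] using hT n _ _ ih
  have h2 : ∀ n m k, (X t : MvPowerSeries ι ℂ) ^ n ∣ s (n + m) k - s n k := by
    intro n m k
    induction m with
    | zero => simp
    | succ m ih =>
      have := dvd_add ((pow_dvd_pow _ (Nat.le_add_right n m)).trans (h1 (n + m) k)) ih
      simpa [add_assoc] using this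
  let u : κ → MvPowerSeries ι ℂ := fun k e => coeff e (s (e t + 1) k)
  have hu : ∀ k n e, e t < n → coeff e (s n k) = coeff e (u k) := by
    intro k n e he
    obtain ⟨m, rfl⟩ := Nat.exists_eq_add_of_lt he
    have := X_pow_dvd_iff.1 (h2 (e t + 1) m k) e (Nat.lt_succ_self _)
    rw [map_sub, sub_eq_zero] at this
    rw [add_right_comm, this]
    rfl
  have hus : ∀ n k, (X t : MvPowerSeries ι ℂ) ^ n ∣ u k - s n k := by
    intro n k
    rw [X_pow_dvd_iff]
    intro e he
    rw [map_sub, hu k n e he, sub_self]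
  refine ⟨u, ?_, fun k => ?_⟩
  · ext k e
    have a1 := X_pow_dvd_iff.1 (hT (e t) _ _ (hus (e t)) k) e (Nat.lt_succ_self _)
    rw [← hs, map_sub, sub_eq_zero] at a1
    rw [a1, hu k _ e (Nat.lt_succ_self _)]
  · unfold wnorm
    rw [ENNReal.tsum_eq_iSup_sum]
    refine iSup_le fun F => ?_
    refine le_trans (le_of_eq ?_) ((ENNReal.sum_le_tsum F).trans (hsb (F.sup (fun e => e t) + 1) k))
    refine Finset.sum_congr rfl fun e he => ?_
    rw [hu k _ e (Nat.lt_succ_of_le (Finset.le_sup (f := fun e : ι →₀ ℕ => e t) he))]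

end FixedPoint

section FormalProblem

variable {μ κ : Type*} [Fintype μ] [Fintype κ]

/-- The formal counterpart of the polynomial `∑ β, c_β u ^ β`. -/
def formalPoly {ι : Type*} (S : Finset (κ → ℕ)) (c : (κ → ℕ) → κ → MvPowerSeries ι ℂ)
    (u : κ → MvPowerSeries ι ℂ) (k : κ) : MvPowerSeries ι ℂ :=
  ∑ β ∈ S, c β k * ∏ j, u j ^ β j

/-- The integral operator whose fixed points are the formal solutions of the Cauchy problem. -/
def picard (S : Finset (κ → ℕ)) (a : μ → MvPowerSeries (Option μ) ℂ)
    (c : (κ → ℕ) → κ → MvPowerSeries (Option μ) ℂ) (v : κ → MvPowerSeries (Option μ) ℂ)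
    (u : κ → MvPowerSeries (Option μ) ℂ) (k : κ) : MvPowerSeries (Option μ) ℂ :=
  v k + antideriv none (formalPoly S c u k - ∑ i, a i * pderiv ℂ (some i) (u k))

variable (S : Finset (κ → ℕ)) (a : μ → MvPowerSeries (Option μ) ℂ)
    (c : (κ → ℕ) → κ → MvPowerSeries (Option μ) ℂ) (v : κ → MvPowerSeries (Option μ) ℂ)

lemma dvd_formalPoly_sub {ι : Type*} (c : (κ → ℕ) → κ → MvPowerSeries ι ℂ)
    {q : MvPowerSeries ι ℂ} {u u' : κ → MvPowerSeries ι ℂ}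
    (h : ∀ k, q ∣ u k - u' k) (k : κ) : q ∣ formalPoly S c u k - formalPoly S c u' k := by
  simp only [← Ideal.mem_span_singleton, ← Ideal.Quotient.mk_eq_mk_iff_sub_mem] at h ⊢
  simp [formalPoly, h]

lemma picard_improves (n : ℕ) (u u' : κ → MvPowerSeries (Option μ) ℂ)
    (h : ∀ k, (X none : MvPowerSeries (Option μ) ℂ) ^ n ∣ u k - u' k) (k : κ) :
    (X none : MvPowerSeries (Option μ) ℂ) ^ (n + 1) ∣ picard S a c v u k - picard S a c v u' k := by
  rw [picard, picard, add_sub_add_left_eq_sub, ← antideriv_sub]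
  refine X_pow_succ_dvd_antideriv ?_
  rw [sub_sub_sub_comm, ← Finset.sum_sub_distrib]
  refine dvd_sub (dvd_formalPoly_sub S c h k) (Finset.dvd_sum fun i _ => ?_)
  rw [← mul_sub, ← map_sub]
  exact Dvd.dvd.mul_left (X_pow_dvd_pderiv (Option.some_ne_none i) (h k)) _

lemma wnorm_formalPoly_le {ι : Type*} (c : (κ → ℕ) → κ → MvPowerSeries ι ℂ)
    {w : (ι →₀ ℕ) → ℝ≥0} (h0 : w 0 = 1)
    (h : ∀ e e', w (e + e') ≤ w e * w e') {K : ℝ≥0∞} {u : κ → MvPowerSeries ι ℂ}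
    (hu : ∀ k, wnorm w (u k) ≤ K) (k : κ) :
    wnorm w (formalPoly S c u k) ≤ ∑ β ∈ S, wnorm w (c β k) * ∏ j, K ^ β j := by
  classical
  refine (wnorm_sum_le _ _ _).trans (Finset.sum_le_sum fun β _ => ?_)
  refine (wnorm_mul_le h _ _).trans ?_
  gcongr
  refine (wnorm_prod_le h0 h _ _).trans (Finset.prod_le_prod' fun j _ => ?_)
  refine (wnorm_pow_le h0 h _ _).trans ?_
  gcongr
  exact hu j

lemma wnorm_picard_le {τ r : ℝ≥0} (hτ : τ ≤ 1) (hr : r ≤ 1) {K : ℝ≥0∞}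
    {u : κ → MvPowerSeries (Option μ) ℂ}
    (hu : ∀ k, wnorm (binomWeight none τ r) (u k) ≤ K) (k : κ) :
    wnorm (binomWeight none τ r) (picard S a c v u k) ≤ wnorm (geo r) (v k) +
      τ * ((∑ β ∈ S, wnorm (geo r) (c β k) * ∏ j, K ^ β j) + ∑ i, wnorm (geo r) (a i) * K) := by
  classical
  have hg : ∀ f : MvPowerSeries (Option μ) ℂ, wnorm (binomWeight none τ r) f ≤ wnorm (geo r) f :=
    wnorm_mono (binomWeight_le_geo none hτ r)
  have hJ : ∀ f : μ → MvPowerSeries (Option μ) ℂ,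
      antideriv none (∑ i, f i) = ∑ i, antideriv none (f i) := by
    intro f
    ext e
    simp [coeff_antideriv, Finset.sum_div]
  refine (wnorm_add_le _ _ _).trans (add_le_add (hg _) ?_)
  rw [antideriv_sub, hJ, mul_add]
  refine (wnorm_sub_le _ _ _).trans (add_le_add ?_ ?_)
  · refine (wnorm_antideriv_le_mul none τ hr _).trans ?_
    gcongr
    refine (wnorm_formalPoly_le S c (binomWeight_zero _ _ _) (binomWeight_add_le _ _ _)
      hu k).trans ?_
    gcongr
    exact hg _
  · refine (wnorm_sum_le _ _ _).trans ?_
    rw [Finset.mul_sum]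
    refine Finset.sum_le_sum fun i _ => ?_
    refine (wnorm_antideriv_mul_pderiv_le (Option.some_ne_none i) τ r _ _).trans ?_
    gcongr
    · exact hg _
    · exact hu k

/-- If the data of the formal Cauchy problem converge, then it has a convergent solution. -/
lemma exists_picard_fixedPoint {r : ℝ≥0} (hr0 : 0 < r) (hr : r ≤ 1)
    (ha : ∀ i, wnorm (geo r) (a i) ≠ ∞) (hc : ∀ β ∈ S, ∀ k, wnorm (geo r) (c β k) ≠ ∞)
    (hv : ∀ k, wnorm (geo r) (v k) ≠ ∞) :
    ∃ u, picard S a c v u = u ∧ ∃ ρ : ℝ≥0, 0 < ρ ∧ ∀ k, wnorm (geo ρ) (u k) ≠ ∞ := by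
  set K : ℝ≥0∞ := (∑ k, wnorm (geo r) (v k)) + 1 with hK
  have hKt : K ≠ ∞ := by
    simp only [hK, ne_eq, ENNReal.add_eq_top, ENNReal.sum_eq_top, not_or]
    exact ⟨fun ⟨k, _, h⟩ => hv k h, ENNReal.one_ne_top⟩
  set C : ℝ≥0∞ := ∑ k, ((∑ β ∈ S, wnorm (geo r) (c β k) * ∏ j, K ^ β j)
    + ∑ i, wnorm (geo r) (a i) * K) with hC
  have hCt : C ≠ ∞ := by
    refine ENNReal.sum_ne_top.2 fun k _ => ENNReal.add_ne_top.2
      ⟨ENNReal.sum_ne_top.2 fun β hβ => ?_, ENNReal.sum_ne_top.2 fun i _ => ?_⟩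
    · exact ENNReal.mul_ne_top (hc β hβ k)
        (ENNReal.prod_ne_top fun j _ => ENNReal.pow_ne_top hKt)
    · exact ENNReal.mul_ne_top (ha i) hKt
  lift C to ℝ≥0 using hCt with C' hC'
  set τ : ℝ≥0 := (C' + 1)⁻¹ with hτdef
  have hτ0 : 0 < τ := by positivity
  have hτ : τ ≤ 1 := inv_le_one_of_one_le₀ (by simp)
  have hτC : (τ : ℝ≥0∞) * C' ≤ 1 := by
    norm_cast
    rw [hτdef, inv_mul_le_iff₀ (by positivity)]
    simp
  obtain ⟨u, hu, hub⟩ := exists_fixedPoint (t := none) (T := picard S a c v)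
    (picard_improves S a c v) (w := binomWeight none τ r) (K := K) (by
      intro u hu k
      refine (wnorm_picard_le S a c v hτ hr hu k).trans ?_
      refine add_le_add (Finset.single_le_sum (f := fun k => wnorm (geo r) (v k))
        (fun _ _ => zero_le) (Finset.mem_univ k)) (le_trans ?_ hτC)
      gcongr
      rw [hC]
      exact Finset.single_le_sum (f := fun k => (∑ β ∈ S, wnorm (geo r) (c β k) * ∏ j, K ^ β j)
        + ∑ i, wnorm (geo r) (a i) * K) (fun _ _ => zero_le) (Finset.mem_univ k))
  refine ⟨u, hu, τ * r / 2, by positivity, fun k => ne_top_of_le_ne_top hKt ?_⟩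
  exact (wnorm_mono (geo_le_binomWeight none hτ r) _).trans (hub k)

end FormalProblem

section Evaluation

variable {ι : Type*}

lemma summable_of_wnorm_ne_top {ρ : ℝ≥0} {u : MvPowerSeries ι ℂ} (hu : wnorm (geo ρ) u ≠ ∞) :
    Summable fun e => ‖coeff e u‖ * geo ρ e := by
  have := ENNReal.summable_toReal hu
  simpa using this

variable [Fintype ι]

/-- The monomial `y ^ e`, with complex values. -/
def mon (y : ι → ℝ) (e : ι →₀ ℕ) : ℂ := ∏ i, (y i : ℂ) ^ e i

lemma mon_zero (y : ι → ℝ) : mon y 0 = 1 := by simp [mon]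

lemma mon_add (y : ι → ℝ) (e e' : ι →₀ ℕ) : mon y (e + e') = mon y e * mon y e' := by
  simp [mon, pow_add, Finset.prod_mul_distrib]

lemma mon_single_one (y : ι → ℝ) (i : ι) : mon y (Finsupp.single i 1) = y i := by
  classical
  rw [mon, Finset.prod_eq_single i]
  · simp
  · intro j _ hj
    simp [Finsupp.single_eq_of_ne hj]
  · simp

lemma norm_mon_le {y : ι → ℝ} {ρ : ℝ≥0} (hy : ‖y‖ ≤ ρ) (e : ι →₀ ℕ) : ‖mon y e‖ ≤ geo ρ e := by
  rw [mon, norm_prod, geo, Finsupp.degree_eq_sum, NNReal.coe_pow, ← Finset.prod_pow_eq_pow_sum]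
  refine Finset.prod_le_prod (fun _ _ => norm_nonneg _) fun i _ => ?_
  rw [norm_pow, Complex.norm_real]
  gcongr
  exact (norm_le_pi_norm y i).trans hy

/-- The sum of a power series at a real point. -/
def ev (u : MvPowerSeries ι ℂ) (y : ι → ℝ) : ℂ := ∑' e, coeff e u * mon y e

/-- The power series `u` converges absolutely at the point `y`, with sum `z`. -/
def HasEv (u : MvPowerSeries ι ℂ) (y : ι → ℝ) (z : ℂ) : Prop :=
  (Summable fun e => ‖coeff e u * mon y e‖) ∧ ev u y = z

lemma hasEv_of_wnorm_ne_top {ρ : ℝ≥0} {u : MvPowerSeries ι ℂ} (hu : wnorm (geo ρ) u ≠ ∞)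
    {y : ι → ℝ} (hy : ‖y‖ ≤ ρ) : HasEv u y (ev u y) := by
  refine ⟨(summable_of_wnorm_ne_top hu).of_nonneg_of_le (fun _ => norm_nonneg _) fun e => ?_, rfl⟩
  rw [norm_mul]
  gcongr
  exact norm_mon_le hy e

variable {u v : MvPowerSeries ι ℂ} {y : ι → ℝ} {z z' : ℂ}

lemma HasEv.hasSum (h : HasEv u y z) : HasSum (fun e => coeff e u * mon y e) z :=
  h.2 ▸ h.1.of_norm.hasSum

lemma HasEv.add (hu : HasEv u y z) (hv : HasEv v y z') : HasEv (u + v) y (z + z') := by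
  refine ⟨(hu.1.add hv.1).of_nonneg_of_le (fun _ => norm_nonneg _) fun e => ?_, ?_⟩
  · rw [map_add, add_mul]
    exact norm_add_le _ _
  · rw [← (hu.hasSum.add hv.hasSum).tsum_eq]
    simp [ev, add_mul]

lemma HasEv.neg (hu : HasEv u y z) : HasEv (-u) y (-z) := by
  refine ⟨by simpa using hu.1, ?_⟩
  rw [← hu.hasSum.neg.tsum_eq]
  simp [ev]

lemma HasEv.sub (hu : HasEv u y z) (hv : HasEv v y z') : HasEv (u - v) y (z - z') := by
  simpa only [sub_eq_add_neg] using hu.add hv.neg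

lemma hasEv_zero (y : ι → ℝ) : HasEv 0 y 0 := by simp [HasEv, ev, summable_zero]

lemma hasEv_one (y : ι → ℝ) : HasEv 1 y 1 := by
  classical
  have h : ∀ e, e ≠ 0 → coeff e (1 : MvPowerSeries ι ℂ) * mon y e = 0 := fun e he => by
    simp [coeff_one, he]
  refine ⟨summable_of_ne_finset_zero (s := {0}) fun e he => ?_, ?_⟩
  · rw [h e (by simpa using he), norm_zero]
  · rw [ev, tsum_eq_single 0 h]
    simp [mon_zero]

lemma HasEv.sum {α : Type*} {s : Finset α} {u : α → MvPowerSeries ι ℂ} {z : α → ℂ}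
    (h : ∀ a ∈ s, HasEv (u a) y (z a)) : HasEv (∑ a ∈ s, u a) y (∑ a ∈ s, z a) := by
  classical
  induction s using Finset.induction_on with
  | empty => simpa using hasEv_zero y
  | insert a s ha ih =>
    rw [Finset.sum_insert ha, Finset.sum_insert ha]
    exact (h a (by simp)).add (ih fun b hb => h b (by simp [hb]))

lemma HasEv.mul (hu : HasEv u y z) (hv : HasEv v y z') : HasEv (u * v) y (z * z') := by
  classical
  have key : ∀ e, coeff e (u * v) * mon y e = ∑ p ∈ antidiagonal e,
      (coeff p.1 u * mon y p.1) * (coeff p.2 v * mon y p.2) := by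
    intro e
    rw [coeff_mul, Finset.sum_mul]
    refine Finset.sum_congr rfl fun p hp => ?_
    rw [← mem_antidiagonal.1 hp, mon_add, mul_mul_mul_comm]
  refine ⟨?_, ?_⟩
  · have h := summable_sum_mul_antidiagonal_of_summable_mul
      (Summable.mul_of_nonneg hu.1 hv.1 (fun _ => norm_nonneg _) (fun _ => norm_nonneg _))
    refine h.of_nonneg_of_le (fun _ => norm_nonneg _) fun e => ?_
    rw [key]
    refine (norm_sum_le _ _).trans (le_of_eq ?_)
    simp only [norm_mul]
  · rw [ev, tsum_congr key, ← Summable.tsum_mul_tsum_eq_tsum_sum_antidiagonal hu.1.of_norm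
      hv.1.of_norm (Summable.mul_norm hu.1 hv.1).of_norm, hu.hasSum.tsum_eq, hv.hasSum.tsum_eq]

lemma HasEv.pow (hu : HasEv u y z) (n : ℕ) : HasEv (u ^ n) y (z ^ n) := by
  induction n with
  | zero => simpa using hasEv_one y
  | succ n ih => simpa only [pow_succ] using ih.mul hu

lemma HasEv.prod {α : Type*} {s : Finset α} {u : α → MvPowerSeries ι ℂ} {z : α → ℂ}
    (h : ∀ a ∈ s, HasEv (u a) y (z a)) : HasEv (∏ a ∈ s, u a) y (∏ a ∈ s, z a) := by
  classical
  induction s using Finset.induction_on with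
  | empty => simpa using hasEv_one y
  | insert a s ha ih =>
    rw [Finset.prod_insert ha, Finset.prod_insert ha]
    exact (h a (by simp)).mul (ih fun b hb => h b (by simp [hb]))

lemma ev_zero_right (u : MvPowerSeries ι ℂ) : ev u 0 = coeff 0 u := by
  classical
  rw [ev, tsum_eq_single 0]
  · simp [mon_zero]
  · intro e he
    obtain ⟨i, hi⟩ := Finsupp.ne_iff.1 he
    have : mon (0 : ι → ℝ) e = 0 := Finset.prod_eq_zero (Finset.mem_univ i) (by simpa using hi)
    rw [this, mul_zero]

end Evaluation

section Derivatives

variable {ι : Type*}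

lemma add_one_mul_pow_le {a b : ℝ≥0} (hab : a ≤ b) (n : ℕ) :
    (b - a) * ((n + 1) * a ^ n) ≤ b ^ (n + 1) := by
  obtain ⟨c, rfl⟩ := exists_add_of_le hab
  rw [add_tsub_cancel_left]
  induction n with
  | zero => simp
  | succ n ih =>
    calc c * ((↑(n + 1) + 1) * a ^ (n + 1)) = c * ((n + 1) * a ^ n) * a + c * a ^ (n + 1) := by
          push_cast; ring
      _ ≤ (a + c) ^ (n + 1) * a + c * (a + c) ^ (n + 1) := by
          gcongr
      _ = _ := by ring

lemma wnorm_pderiv_geo_le {a b : ℝ≥0} (hab : a ≤ b) (i : ι) (u : MvPowerSeries ι ℂ) :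
    ((b - a : ℝ≥0) : ℝ≥0∞) * wnorm (geo a) (pderiv ℂ i u) ≤ wnorm (geo b) u := by
  unfold wnorm
  rw [← ENNReal.tsum_mul_left]
  refine le_trans (ENNReal.tsum_le_tsum fun e => ?_)
    (ENNReal.tsum_comp_le_tsum_of_injective (add_left_injective (Finsupp.single i 1)) _)
  rw [coeff_pderiv, enorm_mul, enorm_natCast_add_one, mul_assoc, mul_left_comm,
    ← ENNReal.coe_mul, ← ENNReal.coe_mul]
  refine mul_le_mul' le_rfl (ENNReal.coe_le_coe.2 ?_)
  simp only [geo, map_add, Finsupp.degree_single]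
  refine le_trans ?_ (add_one_mul_pow_le hab e.degree)
  gcongr
  exact Finsupp.le_degree i e

lemma wnorm_pderiv_ne_top {a b : ℝ≥0} (hab : a < b) (i : ι) {u : MvPowerSeries ι ℂ}
    (hu : wnorm (geo b) u ≠ ∞) : wnorm (geo a) (pderiv ℂ i u) ≠ ∞ := by
  intro h
  have := wnorm_pderiv_geo_le hab.le i u
  rw [h, ENNReal.mul_top (by simpa [tsub_eq_zero_iff_le] using hab)] at this
  exact hu (top_le_iff.1 this)

variable [Fintype ι]

lemma hasDerivAt_mon [DecidableEq ι] (y : ι → ℝ) (i : ι) (e : ι →₀ ℕ) (s : ℝ) :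
    HasDerivAt (fun s : ℝ => mon (y + s • Pi.single i (1 : ℝ)) e)
      (e i * mon (y + s • Pi.single i (1 : ℝ)) (e - Finsupp.single i 1)) s := by
  have h : ∀ (s : ℝ) (e' : ι →₀ ℕ), mon (y + s • Pi.single i (1 : ℝ)) e'
      = ((y i + s : ℝ) : ℂ) ^ e' i * ∏ j ∈ univ.erase i, (y j : ℂ) ^ e' j := by
    intro s e'
    rw [mon, ← Finset.mul_prod_erase _ _ (Finset.mem_univ i)]
    congr 1
    · simp
    · refine Finset.prod_congr rfl fun j hj => ?_
      simp [Pi.single_eq_of_ne (Finset.ne_of_mem_erase hj)]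
  have h' : ∏ j ∈ univ.erase i, (y j : ℂ) ^ ((e - Finsupp.single i 1 : ι →₀ ℕ) j)
      = ∏ j ∈ univ.erase i, (y j : ℂ) ^ e j := by
    refine Finset.prod_congr rfl fun j hj => ?_
    simp [Finsupp.single_eq_of_ne (Finset.ne_of_mem_erase hj)]
  simp only [h, ← mul_assoc]
  rw [h']
  refine HasDerivAt.mul_const (c := fun s : ℝ => ((y i + s : ℝ) : ℂ) ^ e i) ?_ _
  have h1 : HasDerivAt (fun s : ℝ => ((y i + s : ℝ) : ℂ)) 1 s := by
    simpa using ((hasDerivAt_id s).const_add (y i)).ofReal_comp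
  simpa using h1.fun_pow (e i)

lemma hasDerivAt_ev [DecidableEq ι] {ρ : ℝ≥0} {u : MvPowerSeries ι ℂ}
    (hu : wnorm (geo ρ) u ≠ ∞) {y : ι → ℝ} (hy : ‖y‖ < ρ) (i : ι) :
    HasDerivAt (fun s : ℝ => ev u (y + s • Pi.single i (1 : ℝ))) (ev (pderiv ℂ i u) y) 0 := by
  obtain ⟨b, hyb, hbρ⟩ := exists_between hy
  lift b to ℝ≥0 using (norm_nonneg y).trans hyb.le
  have hbρ' : b < ρ := hbρ
  have hinj := add_left_injective (Finsupp.single i 1 : ι →₀ ℕ)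
  have hsupp : ∀ F : (ι →₀ ℕ) → ℂ, (∀ e, e i = 0 → F e = 0) →
      Function.support F ⊆ Set.range (· + (Finsupp.single i 1 : ι →₀ ℕ)) := by
    intro F hF e he
    exact ⟨e - Finsupp.single i 1, tsub_add_cancel_of_le
      (Finsupp.single_le_iff.2 (Nat.one_le_iff_ne_zero.2 fun h => he (hF e h)))⟩
  have hd := summable_of_wnorm_ne_top (wnorm_pderiv_ne_top hbρ' i hu)
  have hS : Summable fun e : ι →₀ ℕ => ‖coeff e u‖ * (e i * geo b (e - Finsupp.single i 1)) := by
    rw [← hinj.summable_iff]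
    · refine hd.congr fun e => ?_
      simp only [Function.comp_apply, coeff_pderiv, Finsupp.add_apply, Finsupp.single_eq_same,
        add_tsub_cancel_right, norm_mul]
      rw [← Nat.cast_succ, Complex.norm_natCast]
      ring
    · intro e he
      have : e i = 0 := by
        by_contra h
        exact he ⟨e - Finsupp.single i 1, tsub_add_cancel_of_le
          (Finsupp.single_le_iff.2 (Nat.one_le_iff_ne_zero.2 h))⟩
      simp [this]
  have hcont : Continuous fun s : ℝ => ‖y + s • Pi.single i (1 : ℝ)‖ := by fun_prop
  obtain ⟨δ, hδ, hball⟩ := Metric.isOpen_iff.1 (isOpen_Iio.preimage hcont) 0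
    (show ‖y + (0 : ℝ) • Pi.single i (1 : ℝ)‖ < b by simpa using hyb)
  have h1 : ∀ e, ∀ s ∈ Metric.ball (0 : ℝ) δ,
      HasDerivAt (fun s : ℝ => coeff e u * mon (y + s • Pi.single i (1 : ℝ)) e)
        (coeff e u * (e i * mon (y + s • Pi.single i (1 : ℝ)) (e - Finsupp.single i 1))) s :=
    fun e s _ => (hasDerivAt_mon y i e s).const_mul _
  have h2 : ∀ e, ∀ s ∈ Metric.ball (0 : ℝ) δ,
      ‖coeff e u * (e i * mon (y + s • Pi.single i (1 : ℝ)) (e - Finsupp.single i 1))‖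
        ≤ ‖coeff e u‖ * (e i * geo b (e - Finsupp.single i 1)) := by
    intro e s hs
    have hs' : ‖y + s • Pi.single i (1 : ℝ)‖ < b := hball hs
    rw [norm_mul, norm_mul, Complex.norm_natCast]
    gcongr
    exact norm_mon_le hs'.le _
  have h3 : Summable fun e => coeff e u * mon (y + (0 : ℝ) • Pi.single i (1 : ℝ)) e := by
    simpa using (hasEv_of_wnorm_ne_top hu hy.le).1.of_norm
  have main := hasDerivAt_tsum_of_isPreconnected hS Metric.isOpen_ball
    (convex_ball (0 : ℝ) δ).isPreconnected h1 h2 (Metric.mem_ball_self hδ) h3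
    (Metric.mem_ball_self hδ)
  refine main.congr_deriv ?_
  rw [← hinj.tsum_eq (hsupp _ fun e he => by simp [he])]
  refine tsum_congr fun e => ?_
  simp [coeff_pderiv]
  ring

end Derivatives

section Analyticity

variable {ι : Type*}

/-- The exponent of the monomial `∏ j, y (w j)` attached to a word `w`. -/
def wordExponent (w : Σ n, Fin n → ι) : ι →₀ ℕ := ∑ j, Finsupp.single (w.2 j) 1

lemma degree_wordExponent (w : Σ n, Fin n → ι) : (wordExponent w).degree = w.1 := by
  simp [wordExponent]

lemma exists_wordExponent_eq (n : ℕ) (e : ι →₀ ℕ) (he : e.degree = n) :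
    ∃ w : Fin n → ι, wordExponent ⟨n, w⟩ = e := by
  induction n generalizing e with
  | zero =>
    refine ⟨Fin.elim0, ?_⟩
    rw [(Finsupp.degree_eq_zero_iff e).1 he]
    simp [wordExponent]
  | succ n ih =>
    have h0 : e ≠ 0 := by
      rintro rfl
      simp at he
    obtain ⟨i, hi⟩ := Finsupp.ne_iff.1 h0
    have h1 : e - Finsupp.single i 1 + Finsupp.single i 1 = e := tsub_add_cancel_of_le
      (Finsupp.single_le_iff.2 (Nat.one_le_iff_ne_zero.2 hi))
    have h2 : (e - Finsupp.single i 1).degree = n := by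
      rw [← h1, map_add, Finsupp.degree_single] at he
      omega
    obtain ⟨w, hw⟩ := ih _ h2
    refine ⟨Fin.cons i w, ?_⟩
    rw [← h1, ← hw]
    simp [wordExponent, Fin.sum_univ_succ, add_comm]

variable [Fintype ι]

lemma mon_wordExponent (y : ι → ℝ) (w : Σ n, Fin n → ι) :
    mon y (wordExponent w) = ∏ j, (y (w.2 j) : ℂ) := by
  classical
  have h : ∀ s : Finset (Fin w.1), mon y (∑ j ∈ s, Finsupp.single (w.2 j) 1)
      = ∏ j ∈ s, (y (w.2 j) : ℂ) := by
    intro s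
    induction s using Finset.induction_on with
    | empty => simp [mon_zero]
    | insert a s ha ih => rw [Finset.sum_insert ha, Finset.prod_insert ha, mon_add, ih,
        mon_single_one]
  exact h univ

lemma exists_multilinear_mon (n : ℕ) (e : ι →₀ ℕ) (he : e.degree = n) :
    ∃ M : ContinuousMultilinearMap ℝ (fun _ : Fin n => ι → ℝ) ℂ,
      ‖M‖ ≤ 1 ∧ ∀ y, M (fun _ => y) = mon y e := by
  obtain ⟨w, hw⟩ := exists_wordExponent_eq n e he
  refine ⟨(ContinuousMultilinearMap.mkPiAlgebra ℝ (Fin n) ℂ).compContinuousLinearMap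
    fun j => Complex.ofRealCLM.comp (ContinuousLinearMap.proj (w j)), ?_, fun y => ?_⟩
  · refine ContinuousMultilinearMap.opNorm_le_bound zero_le_one fun v => ?_
    rw [one_mul]
    simp only [ContinuousMultilinearMap.compContinuousLinearMap_apply,
      ContinuousMultilinearMap.mkPiAlgebra_apply, norm_prod]
    refine Finset.prod_le_prod (fun _ _ => norm_nonneg _) fun j _ => ?_
    simpa using norm_le_pi_norm (v j) (w j)
  · rw [← hw, mon_wordExponent]
    simp

lemma analyticOnNhd_ev {ρ : ℝ≥0} (hρ : 0 < ρ) {u : MvPowerSeries ι ℂ}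
    (hu : wnorm (geo ρ) u ≠ ∞) : AnalyticOnNhd ℝ (ev u) (Metric.ball 0 ρ) := by
  choose M hM1 hM2 using exists_multilinear_mon (ι := ι)
  have hS := summable_of_wnorm_ne_top hu
  have hS' := (Equiv.sigmaFiberEquiv (Finsupp.degree : (ι →₀ ℕ) → ℕ)).summable_iff.2 hS
  let p : FormalMultilinearSeries ℝ (ι → ℝ) ℂ := fun n =>
    ∑' e : {e : ι →₀ ℕ // e.degree = n}, coeff e.1 u • M n e.1 e.2
  have hfib : ∀ n, Summable fun e : {e : ι →₀ ℕ // e.degree = n} => ‖coeff e.1 u‖ := by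
    intro n
    have := hS'.sigma_factor n
    have hpos : ((ρ : ℝ) ^ n) ≠ 0 := by positivity
    rw [← summable_mul_right_iff hpos]
    refine this.congr fun e => ?_
    simp [geo, e.2]
  have hle : ∀ n (e : {e : ι →₀ ℕ // e.degree = n}),
      ‖coeff e.1 u • M n e.1 e.2‖ ≤ ‖coeff e.1 u‖ := by
    intro n e
    rw [norm_smul]
    exact mul_le_of_le_one_right (norm_nonneg _) (hM1 _ _ _)
  have hsm : ∀ n, Summable fun e : {e : ι →₀ ℕ // e.degree = n} => coeff e.1 u • M n e.1 e.2 :=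
    fun n => Summable.of_norm_bounded (hfib n) (hle n)
  have hp : HasFPowerSeriesOnBall (ev u) p 0 ρ := by
    refine ⟨?_, by exact_mod_cast hρ, fun {y} hy => ?_⟩
    · refine p.le_radius_of_summable (hS'.sigma.of_nonneg_of_le (fun n => by positivity) fun n => ?_)
      have h1 : ‖p n‖ ≤ ∑' e : {e : ι →₀ ℕ // e.degree = n}, ‖coeff e.1 u‖ :=
        tsum_of_norm_bounded (hfib n).hasSum (hle n)
      refine (mul_le_mul_of_nonneg_right h1 (by positivity)).trans (le_of_eq ?_)
      rw [← tsum_mul_right]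
      refine tsum_congr fun e => ?_
      simp [geo, e.2]
    · have hy' : ‖y‖ ≤ ρ := by
        rw [Metric.mem_eball, edist_zero_right, enorm_eq_nnnorm] at hy
        exact_mod_cast hy.le
      have h1 := (Equiv.sigmaFiberEquiv (Finsupp.degree : (ι →₀ ℕ) → ℕ)).hasSum_iff.2
        (hasEv_of_wnorm_ne_top hu hy').hasSum
      rw [zero_add]
      refine h1.sigma fun n => ?_
      have h2 := ContinuousMultilinearMap.hasSum_eval (hsm n).hasSum (fun _ => y)
      refine h2.congr_fun ?_
      intro e
      simp [hM2]
  have := hp.analyticOnNhd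
  rwa [Metric.eball_coe] at this

/-- A real-analytic function is the sum of a convergent power series in the coordinates. -/
lemma exists_expansion {f : (ι → ℝ) → ℂ} (hf : AnalyticAt ℝ f 0) :
    ∃ u : MvPowerSeries ι ℂ, ∃ ρ : ℝ≥0, 0 < ρ ∧ wnorm (geo ρ) u ≠ ∞ ∧
      ∀ y, ‖y‖ < ρ → f y = ev u y := by
  classical
  obtain ⟨p, R, hp⟩ := hf
  obtain ⟨R', hR'0, hR'⟩ := ENNReal.lt_iff_exists_nnreal_btwn.1 hp.r_pos
  have hRpos : 0 < R' := by exact_mod_cast hR'0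
  have hsum := p.summable_norm_mul_pow (hR'.trans_le hp.r_le)
  let P : (Σ n, Fin n → ι) → ℂ := fun w => p w.1 fun j => Pi.single (w.2 j) (1 : ℝ)
  have hP : ∀ w, ‖P w‖ ≤ ‖p w.1‖ := by
    intro w
    refine (ContinuousMultilinearMap.le_opNorm _ _).trans ?_
    simp [Pi.norm_single]
  let u : MvPowerSeries ι ℂ := fun e => ∑' w : {w // wordExponent w = e}, P w.1
  let ρ : ℝ≥0 := R' / (Fintype.card ι + 1)
  have hρ0 : 0 < ρ := by positivity
  have hρ : Fintype.card ι * ρ ≤ R' := by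
    rw [show Fintype.card ι * ρ = Fintype.card ι * R' / (Fintype.card ι + 1) by
      simp only [ρ]; ring]
    rw [div_le_iff₀ (by positivity), mul_comm]
    gcongr
    simp
  have hbound : ∑' w, ‖P w‖ₑ * (ρ ^ w.1 : ℝ≥0) ≠ ∞ := by
    refine ne_top_of_le_ne_top (b := ∑' n, ‖p n‖ₑ * (R' ^ n : ℝ≥0)) ?_ ?_
    · have h : Summable fun n => ‖p n‖₊ * R' ^ n :=
        NNReal.summable_coe.1 (by simpa using hsum)
      simpa [enorm_eq_nnnorm] using ENNReal.tsum_coe_ne_top_iff_summable.2 h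
    · rw [ENNReal.tsum_sigma']
      refine ENNReal.tsum_le_tsum fun n => ?_
      rw [tsum_fintype]
      calc _ ≤ ∑ w : Fin n → ι, ‖p n‖ₑ * (ρ ^ n : ℝ≥0) := by
            refine Finset.sum_le_sum fun w _ => ?_
            gcongr
            exact enorm_le_iff_norm_le.2 (hP ⟨n, w⟩)
        _ = ‖p n‖ₑ * ((Fintype.card ι * ρ) ^ n : ℝ≥0) := by
            simp [mul_pow]
            ring
        _ ≤ _ := by gcongr
  have hu : wnorm (geo ρ) u ≠ ∞ := by
    refine ne_top_of_le_ne_top hbound ?_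
    rw [← (Equiv.sigmaFiberEquiv (wordExponent (ι := ι))).tsum_eq, ENNReal.tsum_sigma']
    refine ENNReal.tsum_le_tsum fun e => ?_
    calc ‖coeff e u‖ₑ * (geo ρ e : ℝ≥0∞)
        ≤ (∑' w : {w // wordExponent w = e}, ‖P w.1‖ₑ) * (geo ρ e : ℝ≥0∞) := by
          gcongr
          exact enorm_tsum_le_tsum_enorm
      _ = _ := by
          rw [← ENNReal.tsum_mul_right]
          refine tsum_congr fun w => ?_
          simp only [Equiv.sigmaFiberEquiv_apply, geo]
          rw [← degree_wordExponent w.1, w.2]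
  refine ⟨u, ρ, hρ0, hu, fun y hy => ?_⟩
  have hS : Summable fun w => P w * mon y (wordExponent w) := by
    have := ENNReal.summable_toReal hbound
    refine Summable.of_norm_bounded this fun w => ?_
    rw [norm_mul]
    simp only [ENNReal.toReal_mul, toReal_enorm, ENNReal.coe_toReal]
    gcongr
    refine (norm_mon_le hy.le _).trans (le_of_eq ?_)
    simp [geo, degree_wordExponent]
  have hyR : y ∈ Metric.eball (0 : ι → ℝ) R := by
    have h : ρ ≤ R' := div_le_self zero_le (by simp)
    have h' : ‖y‖₊ < R' := lt_of_lt_of_le (by exact_mod_cast hy) h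
    rw [Metric.mem_eball, edist_zero_right, enorm_eq_nnnorm]
    exact lt_trans (by exact_mod_cast h') hR'
  have hsum_words : ∀ n, ∑' w : Fin n → ι, P ⟨n, w⟩ * mon y (wordExponent ⟨n, w⟩)
      = p n fun _ => y := by
    intro n
    rw [tsum_fintype]
    have hy' : y = ∑ i, y i • (Pi.single i (1 : ℝ) : ι → ℝ) := by
      ext j
      simp [Finset.sum_apply, Pi.single_apply]
    conv_rhs => rw [hy']
    rw [ContinuousMultilinearMap.map_sum]
    refine Finset.sum_congr rfl fun w _ => ?_
    rw [ContinuousMultilinearMap.map_smul_univ, mon_wordExponent, mul_comm]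
    simp [P]
  have h1 : f y = ∑' w, P w * mon y (wordExponent w) := by
    rw [hS.tsum_sigma, tsum_congr hsum_words, (hp.hasSum hyR).tsum_eq, zero_add]
  rw [h1, ev, ← (Equiv.sigmaFiberEquiv (wordExponent (ι := ι))).tsum_eq]
  refine ((Equiv.sigmaFiberEquiv
    (wordExponent (ι := ι))).summable_iff.2 hS).tsum_sigma.trans ?_
  refine tsum_congr fun e => ?_
  rw [coeff_apply, ← tsum_mul_right]
  refine tsum_congr fun w => ?_
  simp [w.2]

end Analyticity

section Taylor

variable {ι : Type*} [Fintype ι] {u : MvPowerSeries ι ℂ}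

lemma fderiv_ev [DecidableEq ι] {ρ : ℝ≥0} (hu : wnorm (geo ρ) u ≠ ∞) {y : ι → ℝ} (hy : ‖y‖ < ρ)
    (i : ι) : fderiv ℝ (ev u) y (Pi.single i 1) = ev (pderiv ℂ i u) y := by
  have hρ : 0 < ρ := by exact_mod_cast (norm_nonneg y).trans_lt hy
  have h := (analyticOnNhd_ev hρ hu y (by simpa using hy)).differentiableAt.hasFDerivAt
  exact (h.hasLineDerivAt (Pi.single i 1)).unique (hasDerivAt_ev hu hy i)

lemma wnorm_ne_top_of_hasEv {r : ℝ≥0} {z : ℂ} (h : HasEv u (fun _ => (r : ℝ)) z) :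
    wnorm (geo r) u ≠ ∞ := by
  have h1 : Summable fun e => ‖coeff e u‖₊ * geo r e := by
    rw [← NNReal.summable_coe]
    refine h.1.congr fun e => ?_
    rw [norm_mul, mon, Finset.prod_pow_eq_pow_sum, ← Finsupp.degree_eq_sum]
    simp [geo]
  simpa [wnorm, enorm_eq_nnnorm] using ENNReal.tsum_coe_ne_top_iff_summable.2 h1

lemma coeff_eq_zero_of_ev_eq_zero (n : ℕ) : ∀ (e : ι →₀ ℕ), e.degree = n → ∀ (ρ : ℝ≥0), 0 < ρ →
    ∀ u : MvPowerSeries ι ℂ, wnorm (geo ρ) u ≠ ∞ → (∀ y, ‖y‖ < ρ → ev u y = 0) →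
      coeff e u = 0 := by
  classical
  induction n with
  | zero =>
    intro e he ρ hρ u _ h
    rw [(Finsupp.degree_eq_zero_iff e).1 he, ← ev_zero_right]
    exact h 0 (by simpa using hρ)
  | succ n ih =>
    intro e he ρ hρ u hu h
    have h0 : e ≠ 0 := by
      rintro rfl
      simp at he
    obtain ⟨i, hi⟩ := Finsupp.ne_iff.1 h0
    have h1 : e - Finsupp.single i 1 + Finsupp.single i 1 = e := tsub_add_cancel_of_le
      (Finsupp.single_le_iff.2 (Nat.one_le_iff_ne_zero.2 hi))
    have h2 : (e - Finsupp.single i 1).degree = n := by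
      rw [← h1, map_add, Finsupp.degree_single] at he
      omega
    have hlt : ρ / 2 < ρ := NNReal.half_lt_self hρ.ne'
    have h3 := ih _ h2 (ρ / 2) (by positivity) (pderiv ℂ i u) (wnorm_pderiv_ne_top hlt i hu) (by
      intro y hy
      have hy' : ‖y‖ < ρ := hy.trans (by exact_mod_cast hlt)
      rw [← fderiv_ev hu hy' i]
      have : ev u =ᶠ[nhds y] fun _ => 0 := by
        filter_upwards [(isOpen_lt continuous_norm continuous_const).mem_nhds hy'] with z hz
        exact h z hz
      simp [this.fderiv_eq])
    rw [coeff_pderiv, h1] at h3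
    exact (mul_eq_zero.1 h3).resolve_right (Nat.cast_add_one_ne_zero _)

lemma eq_zero_of_hasEv_zero {ρ : ℝ≥0} (hρ : 0 < ρ) (h : ∀ y, ‖y‖ < ρ → HasEv u y 0) : u = 0 := by
  have hlt : ρ / 2 < ρ := NNReal.half_lt_self hρ.ne'
  have hlt' : ((ρ / 2 : ℝ≥0) : ℝ) < ρ := by exact_mod_cast hlt
  have h1 : wnorm (geo (ρ / 2)) u ≠ ∞ := wnorm_ne_top_of_hasEv (h _ (by
    refine lt_of_le_of_lt ((pi_norm_le_iff_of_nonneg (by positivity)).2 fun i => ?_) hlt'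
    simp))
  ext e
  exact coeff_eq_zero_of_ev_eq_zero _ e rfl _ (by positivity) u h1 fun y hy => (h y (hy.trans hlt')).2

end Taylor

section Restriction

variable {ι : Type*} (t : ι) (u v : MvPowerSeries ι ℂ)

/-- The restriction of a power series to the hyperplane `t = 0`. -/
def restrict : MvPowerSeries ι ℂ := fun e => if e t = 0 then coeff e u else 0

lemma coeff_restrict (e : ι →₀ ℕ) : coeff e (restrict t u) = if e t = 0 then coeff e u else 0 := rfl

lemma restrict_sub : restrict t (u - v) = restrict t u - restrict t v := by
  ext e
  simp only [coeff_restrict, map_sub]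
  split_ifs <;> simp

lemma pderiv_restrict : pderiv ℂ t (restrict t u) = 0 := by
  ext e
  simp [coeff_pderiv, coeff_restrict]

lemma restrict_add_antideriv_pderiv : restrict t u + antideriv t (pderiv ℂ t u) = u := by
  ext e
  rw [map_add, coeff_restrict, coeff_antideriv, coeff_pderiv]
  split_ifs with h
  · simp [h]
  · have h1 : e - Finsupp.single t 1 + Finsupp.single t 1 = e := tsub_add_cancel_of_le
      (Finsupp.single_le_iff.2 (Nat.one_le_iff_ne_zero.2 h))
    have h2 : (((e - Finsupp.single t 1 : ι →₀ ℕ) t : ℕ) : ℂ) + 1 = e t := by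
      rw [← Nat.cast_succ]
      congr 1
      simp only [Finsupp.tsub_apply, Finsupp.single_eq_same]
      omega
    rw [h1, h2, zero_add, mul_div_cancel_right₀]
    exact_mod_cast h

lemma wnorm_restrict_le (w : (ι →₀ ℕ) → ℝ≥0) : wnorm w (restrict t u) ≤ wnorm w u := by
  refine ENNReal.tsum_le_tsum fun e => ?_
  rw [coeff_restrict]
  split_ifs <;> simp

variable [Fintype ι] {t}

lemma mon_eq_zero {y : ι → ℝ} (hy : y t = 0) {e : ι →₀ ℕ} (he : e t ≠ 0) : mon y e = 0 :=
  Finset.prod_eq_zero (Finset.mem_univ t) (by simp [hy, he])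

lemma ev_restrict {y : ι → ℝ} (hy : y t = 0) : ev (restrict t u) y = ev u y := by
  refine tsum_congr fun e => ?_
  rw [coeff_restrict]
  split_ifs with h
  · rfl
  · simp [mon_eq_zero hy h]

lemma ev_restrict_update [DecidableEq ι] (y : ι → ℝ) :
    ev (restrict t u) (Function.update y t 0) = ev (restrict t u) y := by
  refine tsum_congr fun e => ?_
  rw [coeff_restrict]
  split_ifs with h
  · congr 1
    refine Finset.prod_congr rfl fun i _ => ?_
    by_cases hi : i = t
    · subst hi
      simp [h]
    · simp [hi]
  · simp

end Restriction

section Coordinates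

variable {m : ℕ}

/-- The coordinates of `ℝ × ℝ^m`, indexed by `Option (Fin m)`. -/
def coords (m : ℕ) : (ℝ × (Fin m → ℝ)) →L[ℝ] (Option (Fin m) → ℝ) :=
  ContinuousLinearMap.pi fun o => o.elim (ContinuousLinearMap.fst ℝ ℝ (Fin m → ℝ))
    fun i => (ContinuousLinearMap.proj i).comp (ContinuousLinearMap.snd ℝ ℝ (Fin m → ℝ))

/-- The inverse of `coords`. -/
def coordsInv (m : ℕ) : (Option (Fin m) → ℝ) →L[ℝ] (ℝ × (Fin m → ℝ)) :=
  (ContinuousLinearMap.proj none).prod (ContinuousLinearMap.pi fun i =>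
    ContinuousLinearMap.proj (some i))

@[simp] lemma coords_none (p : ℝ × (Fin m → ℝ)) : coords m p none = p.1 := rfl

@[simp] lemma coords_some (p : ℝ × (Fin m → ℝ)) (i : Fin m) : coords m p (some i) = p.2 i := rfl

lemma coordsInv_coords (p : ℝ × (Fin m → ℝ)) : coordsInv m (coords m p) = p := rfl

lemma coords_coordsInv (y : Option (Fin m) → ℝ) : coords m (coordsInv m y) = y := by
  ext o
  cases o <;> rfl

lemma norm_coords (p : ℝ × (Fin m → ℝ)) : ‖coords m p‖ = ‖p‖ := by
  refine le_antisymm ((pi_norm_le_iff_of_nonneg (norm_nonneg _)).2 fun o => ?_)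
    (norm_prod_le_iff.2 ⟨?_, (pi_norm_le_iff_of_nonneg (norm_nonneg _)).2 fun i => ?_⟩)
  · cases o with
    | none => exact norm_fst_le p
    | some i => exact (norm_le_pi_norm p.2 i).trans (norm_snd_le p)
  · exact norm_le_pi_norm (coords m p) none
  · exact norm_le_pi_norm (coords m p) (some i)

lemma coords_time : coords m (1, 0) = Pi.single none 1 := by
  ext o
  cases o <;> simp

lemma coords_space (i : Fin m) : coords m (0, Pi.single i 1) = Pi.single (some i) 1 := by
  ext o
  cases o with
  | none => simp
  | some j => simp [Pi.single_apply]

/-- The power series `u` converges on the ball of radius `ρ` and represents there the function `f`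
near the point `p₀`. -/
def Represents (p₀ : ℝ × (Fin m → ℝ)) (ρ : ℝ≥0) (f : ℝ × (Fin m → ℝ) → ℂ)
    (u : MvPowerSeries (Option (Fin m)) ℂ) : Prop :=
  wnorm (geo ρ) u ≠ ∞ ∧ ∀ p, ‖p - p₀‖ < ρ → f p = ev u (coords m (p - p₀))

lemma Represents.mono {p₀ : ℝ × (Fin m → ℝ)} {ρ ρ' : ℝ≥0} {f : ℝ × (Fin m → ℝ) → ℂ}
    {u : MvPowerSeries (Option (Fin m)) ℂ} (h : Represents p₀ ρ f u) (hρ : ρ' ≤ ρ) :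
    Represents p₀ ρ' f u :=
  ⟨ne_top_of_le_ne_top h.1 (wnorm_mono (fun e => pow_le_pow_left' hρ _) u),
    fun p hp => h.2 p (hp.trans_le (by exact_mod_cast hρ))⟩

lemma exists_represents {p₀ : ℝ × (Fin m → ℝ)} {f : ℝ × (Fin m → ℝ) → ℂ}
    (hf : AnalyticAt ℝ f p₀) :
    ∃ u, ∀ᶠ ρ in nhdsWithin (0 : ℝ≥0) (Set.Ioi 0), Represents p₀ ρ f u := by
  have h : AnalyticAt ℝ (fun y => f (p₀ + coordsInv m y)) 0 := by
    refine AnalyticAt.fun_comp (by simpa using hf) ?_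
    exact analyticAt_const.add ((coordsInv m).analyticAt 0)
  obtain ⟨u, ρ, hρ, hu, hfu⟩ := exists_expansion h
  refine ⟨u, ?_⟩
  filter_upwards [Ioo_mem_nhdsGT hρ] with ρ' hρ'
  refine Represents.mono (ρ := ρ) ⟨hu, fun p hp => ?_⟩ hρ'.2.le
  rw [← hfu _ (by rwa [norm_coords]), coordsInv_coords, add_sub_cancel]

lemma exists_represents_finset {α : Type*} (s : Finset α) {p₀ : ℝ × (Fin m → ℝ)}
    {f : α → ℝ × (Fin m → ℝ) → ℂ} (hf : ∀ a ∈ s, AnalyticAt ℝ (f a) p₀) :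
    ∃ u : α → MvPowerSeries (Option (Fin m)) ℂ,
      ∀ᶠ ρ in nhdsWithin (0 : ℝ≥0) (Set.Ioi 0), ∀ a ∈ s, Represents p₀ ρ (f a) (u a) := by
  have h : ∀ a, ∃ u, a ∈ s → ∀ᶠ ρ in nhdsWithin (0 : ℝ≥0) (Set.Ioi 0), Represents p₀ ρ (f a) u := by
    intro a
    by_cases ha : a ∈ s
    · obtain ⟨u, hu⟩ := exists_represents (hf a ha)
      exact ⟨u, fun _ => hu⟩
    · exact ⟨0, fun h => absurd h ha⟩
  choose u hu using h
  exact ⟨u, (Filter.eventually_all_finset s).2 hu⟩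

lemma Represents.fderiv_apply {p₀ : ℝ × (Fin m → ℝ)} {ρ : ℝ≥0} {f : ℝ × (Fin m → ℝ) → ℂ}
    {u : MvPowerSeries (Option (Fin m)) ℂ} (h : Represents p₀ ρ f u) {p : ℝ × (Fin m → ℝ)}
    (hp : ‖p - p₀‖ < ρ) {v : ℝ × (Fin m → ℝ)} {o : Option (Fin m)}
    (hv : coords m v = Pi.single o 1) :
    HasEv (pderiv ℂ o u) (coords m (p - p₀)) (fderiv ℝ f p v) := by
  have hρ : 0 < ρ := by exact_mod_cast (norm_nonneg _).trans_lt hp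
  have hy : ‖coords m (p - p₀)‖ < ρ := by rwa [norm_coords]
  obtain ⟨b, hb, hbρ⟩ := exists_between hy
  lift b to ℝ≥0 using (norm_nonneg _).trans hb.le
  have h1 := hasEv_of_wnorm_ne_top (wnorm_pderiv_ne_top (by exact_mod_cast hbρ) o h.1) hb.le
  have h2 : f =ᶠ[nhds p] fun q => ev u (coords m (q - p₀)) := by
    have : Continuous fun q : ℝ × (Fin m → ℝ) => ‖q - p₀‖ := by fun_prop
    filter_upwards [(isOpen_lt this continuous_const).mem_nhds hp] with q hq
    exact h.2 q hq
  have h3 : HasFDerivAt (fun q => ev u (coords m (q - p₀)))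
      ((fderiv ℝ (ev u) (coords m (p - p₀))).comp (coords m)) p := by
    have h4 := (analyticOnNhd_ev hρ h.1 (coords m (p - p₀))
      (by simpa only [Metric.mem_ball, dist_zero_right] using hy)).differentiableAt.hasFDerivAt
    have h5 : HasFDerivAt (fun q => coords m (q - p₀)) (coords m) p :=
      (coords m).hasFDerivAt.comp p ((hasFDerivAt_id p).sub_const p₀)
    exact HasFDerivAt.comp (g := ev u) p h4 h5
  rw [h2.fderiv_eq, h3.fderiv, ContinuousLinearMap.comp_apply, hv, fderiv_ev h.1 hy]
  exact h1

end Coordinates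

section FormalEquation

variable {μ κ : Type*} [Fintype μ] [Fintype κ] (S : Finset (κ → ℕ))
    (a : μ → MvPowerSeries (Option μ) ℂ) (c : (κ → ℕ) → κ → MvPowerSeries (Option μ) ℂ)
    (u v : κ → MvPowerSeries (Option μ) ℂ)

/-- The difference of the two sides of the differential equation for a tuple of power series. -/
def residual (k : κ) : MvPowerSeries (Option μ) ℂ :=
  pderiv ℂ none (u k) + ∑ i, a i * pderiv ℂ (some i) (u k) - formalPoly S c u k

lemma residual_eq_zero_iff (k : κ) : residual S a c u k = 0 ↔
    formalPoly S c u k - ∑ i, a i * pderiv ℂ (some i) (u k) = pderiv ℂ none (u k) := by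
  rw [residual, sub_eq_zero, sub_eq_iff_eq_add, eq_comm]

lemma picard_eq_self_iff : picard S a c (fun k => restrict none (v k)) u = u ↔
    ∀ k, residual S a c u k = 0 ∧ restrict none (u k) = restrict none (v k) := by
  simp only [residual_eq_zero_iff, funext_iff, picard]
  refine forall_congr' fun k => ⟨fun h => ?_, fun ⟨h, h'⟩ => ?_⟩
  · have h1 : formalPoly S c u k - ∑ i, a i * pderiv ℂ (some i) (u k) = pderiv ℂ none (u k) := by
      conv_rhs => rw [← h]
      rw [map_add, pderiv_restrict, pderiv_antideriv, zero_add]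
    refine ⟨h1, ?_⟩
    rw [h1] at h
    exact add_right_cancel ((restrict_add_antideriv_pderiv none (u k)).trans h.symm)
  · rw [h, ← h', restrict_add_antideriv_pderiv]

end FormalEquation

section Bridge

variable {m N d : ℕ} {p₀ p : ℝ × (Fin m → ℝ)} {ρ : ℝ≥0}

lemma Represents.analyticAt {f : ℝ × (Fin m → ℝ) → ℂ} {u : MvPowerSeries (Option (Fin m)) ℂ}
    (h : Represents p₀ ρ f u) (hp : ‖p - p₀‖ < ρ) : AnalyticAt ℝ f p := by
  have hρ : 0 < ρ := by exact_mod_cast (norm_nonneg _).trans_lt hp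
  have h1 : AnalyticAt ℝ (fun q => ev u (coords m (q - p₀))) p := by
    refine AnalyticAt.fun_comp (analyticOnNhd_ev hρ h.1 _ ?_) ?_
    · rwa [Metric.mem_ball, dist_zero_right, norm_coords]
    · exact ((coords m).analyticAt _).fun_comp (analyticAt_id.sub analyticAt_const)
  refine h1.congr ?_
  have : Continuous fun q : ℝ × (Fin m → ℝ) => ‖q - p₀‖ := by fun_prop
  filter_upwards [(isOpen_lt this continuous_const).mem_nhds hp] with q hq
  exact (h.2 q hq).symm

lemma Represents.hasEv {f : ℝ × (Fin m → ℝ) → ℂ} {u : MvPowerSeries (Option (Fin m)) ℂ}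
    (h : Represents p₀ ρ f u) (hp : ‖p - p₀‖ < ρ) : HasEv u (coords m (p - p₀)) (f p) := by
  rw [h.2 p hp]
  exact hasEv_of_wnorm_ne_top h.1 (by rw [norm_coords]; exact hp.le)

variable {A : ℝ × (Fin m → ℝ) → Fin m → ℂ} {a : Fin m → MvPowerSeries (Option (Fin m)) ℂ}
    {c : (Fin N → ℕ) → ℝ × (Fin m → ℝ) → Fin N → ℂ}
    {b : (Fin N → ℕ) → Fin N → MvPowerSeries (Option (Fin m)) ℂ}
    {U : ℝ × (Fin m → ℝ) → Fin N → ℂ} {u : Fin N → MvPowerSeries (Option (Fin m)) ℂ}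

lemma hasEv_residual (ha : ∀ i, Represents p₀ ρ (fun p => A p i) (a i))
    (hb : ∀ β ∈ multiIdxSet N d, ∀ k, Represents p₀ ρ (fun p => c β p k) (b β k))
    (hu : ∀ k, Represents p₀ ρ (fun p => U p k) (u k)) (hp : ‖p - p₀‖ < ρ) (k : Fin N) :
    HasEv (residual (multiIdxSet N d) a b u k) (coords m (p - p₀))
      ((fderiv ℝ U p (1, 0) + ∑ i, A p i • fderiv ℝ U p (0, Pi.single i 1)
        - polyP d c p (U p)) k) := by
  have hU : ∀ v, fderiv ℝ U p v k = fderiv ℝ (fun q => U q k) p v := fun v => by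
    have h : DifferentiableAt ℝ U p :=
      differentiableAt_pi.2 fun k => ((hu k).analyticAt hp).differentiableAt
    rw [(hasFDerivAt_pi'.1 h.hasFDerivAt k).fderiv]
    rfl
  simp only [Pi.sub_apply, Pi.add_apply, Finset.sum_apply, Pi.smul_apply, smul_eq_mul, hU, polyP]
  refine (((hu k).fderiv_apply hp coords_time).add (HasEv.sum fun i _ => ?_)).sub
    (HasEv.sum fun β hβ => ?_)
  · exact ((ha i).hasEv hp).mul ((hu k).fderiv_apply hp (coords_space i))
  · exact ((hb β hβ k).hasEv hp).mul (HasEv.prod fun j _ => ((hu j).hasEv hp).pow _)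

lemma residual_eq_zero (hρ : 0 < ρ) (ha : ∀ i, Represents p₀ ρ (fun p => A p i) (a i))
    (hb : ∀ β ∈ multiIdxSet N d, ∀ k, Represents p₀ ρ (fun p => c β p k) (b β k))
    (hu : ∀ k, Represents p₀ ρ (fun p => U p k) (u k)) {s : Set (ℝ × (Fin m → ℝ))}
    (hs : ∀ p, ‖p - p₀‖ < ρ → p ∈ s) (hU : SolvesPDE A d c U s) (k : Fin N) :
    residual (multiIdxSet N d) a b u k = 0 := by
  refine eq_zero_of_hasEv_zero hρ fun y hy => ?_
  have hp : ‖p₀ + coordsInv m y - p₀‖ < ρ := by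
    rwa [add_sub_cancel_left, ← norm_coords, coords_coordsInv]
  have h := hasEv_residual ha hb hu hp k
  rwa [hU _ (hs _ hp), sub_self, Pi.zero_apply, add_sub_cancel_left, coords_coordsInv] at h

lemma solvesPDE_of_residual_eq_zero (ha : ∀ i, Represents p₀ ρ (fun p => A p i) (a i))
    (hb : ∀ β ∈ multiIdxSet N d, ∀ k, Represents p₀ ρ (fun p => c β p k) (b β k))
    (hu : ∀ k, Represents p₀ ρ (fun p => U p k) (u k)) {s : Set (ℝ × (Fin m → ℝ))}
    (hs : ∀ p ∈ s, ‖p - p₀‖ < ρ) (h : ∀ k, residual (multiIdxSet N d) a b u k = 0) :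
    SolvesPDE A d c U s := by
  intro p hp
  refine sub_eq_zero.1 (funext fun k => ?_)
  have h1 := hasEv_residual ha hb hu (hs p hp) k
  rw [h k] at h1
  exact h1.2.symm.trans (hasEv_zero _).2

lemma restrict_eq_restrict (hρ : 0 < ρ) {f g : ℝ × (Fin m → ℝ) → ℂ}
    {v w : MvPowerSeries (Option (Fin m)) ℂ} (hf : Represents p₀ ρ f v) (hg : Represents p₀ ρ g w)
    (h : ∀ x, ‖x - p₀.2‖ < ρ → f (p₀.1, x) = g (p₀.1, x)) : restrict none v = restrict none w := by
  rw [← sub_eq_zero, ← restrict_sub]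
  have hvw : ∀ y, ‖y‖ < ρ → HasEv (v - w) y (ev v y - ev w y) := fun y hy =>
    (hasEv_of_wnorm_ne_top hf.1 hy.le).sub (hasEv_of_wnorm_ne_top hg.1 hy.le)
  refine eq_zero_of_hasEv_zero hρ fun y hy => ?_
  have h1 := hasEv_of_wnorm_ne_top (ne_top_of_le_ne_top (ENNReal.add_ne_top.2 ⟨hf.1, hg.1⟩)
    ((wnorm_restrict_le none (v - w) _).trans (wnorm_sub_le _ _ _))) hy.le
  set z := Function.update y none 0 with hz
  have hz0 : z none = 0 := by simp [hz]
  have hzρ : ‖z‖ < ρ := by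
    refine lt_of_le_of_lt ((pi_norm_le_iff_of_nonneg (norm_nonneg _)).2 fun o => ?_) hy
    cases o with
    | none => simp [hz]
    | some i => simpa [hz] using norm_le_pi_norm y (some i)
  have hp : ‖p₀ + coordsInv m z - p₀‖ < ρ := by
    rwa [add_sub_cancel_left, ← norm_coords, coords_coordsInv]
  have hpe : p₀ + coordsInv m z = (p₀.1, (p₀ + coordsInv m z).2) :=
    Prod.ext (by simp [coordsInv, hz0]) rfl
  have h2 := hf.2 _ hp
  have h3 := hg.2 _ hp
  have h4 := h (p₀ + coordsInv m z).2 ((norm_snd_le (p₀ + coordsInv m z - p₀)).trans_lt hp)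
  rw [← hpe, h2, h3, add_sub_cancel_left, coords_coordsInv] at h4
  rwa [← ev_restrict_update, ← hz, ev_restrict _ hz0, (hvw z hzρ).2, h4, sub_self] at h1

end Bridge

end CauchyKovalevskaya

open CauchyKovalevskaya
open scoped NNReal

/-- **Local part of Sublemma 5.3.** Real-analytic local solvability and local uniqueness of
first-order systems `∂U/∂t + Σ_i Aⁱ·∂U/∂xⁱ = P(t,x,U)` with real-analytic complex-valued
coefficients and real-analytic initial datum `U(t₀,·) = V`. -/
theorem statement5 (m N d : ℕ) (hm : 1 ≤ m) (hN : 1 ≤ N)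
    (t₀ : ℝ) (x₀ : Fin m → ℝ)
    (W : Set (ℝ × (Fin m → ℝ))) (hW : IsOpen W) (hW₀ : (t₀, x₀) ∈ W)
    (A : (ℝ × (Fin m → ℝ)) → (Fin m → ℂ)) (hA : AnalyticOnNhd ℝ A W)
    (c : (Fin N → ℕ) → (ℝ × (Fin m → ℝ)) → (Fin N → ℂ))
    (hc : ∀ β ∈ multiIdxSet N d, AnalyticOnNhd ℝ (c β) W)
    (V : (Fin m → ℝ) → (Fin N → ℂ))
    (U₀ : Set (Fin m → ℝ)) (hU₀ : IsOpen U₀) (hx₀ : x₀ ∈ U₀)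
    (hV : AnalyticOnNhd ℝ V U₀) :
    (∃ ε > (0 : ℝ), ∃ Ω : Set (Fin m → ℝ), IsOpen Ω ∧ x₀ ∈ Ω ∧
      Set.Ioo (t₀ - ε) (t₀ + ε) ×ˢ Ω ⊆ W ∧
      ∃ U : ℝ × (Fin m → ℝ) → (Fin N → ℂ),
        AnalyticOnNhd ℝ U (Set.Ioo (t₀ - ε) (t₀ + ε) ×ˢ Ω)
        ∧ SolvesPDE A d c U (Set.Ioo (t₀ - ε) (t₀ + ε) ×ˢ Ω)
        ∧ ∀ x ∈ Ω, U (t₀, x) = V x)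
    ∧
    (∀ (U₁ U₂ : ℝ × (Fin m → ℝ) → (Fin N → ℂ)) (W₁ : Set (ℝ × (Fin m → ℝ))),
      IsOpen W₁ → (t₀, x₀) ∈ W₁ → W₁ ⊆ W →
      AnalyticOnNhd ℝ U₁ W₁ → AnalyticOnNhd ℝ U₂ W₁ →
      SolvesPDE A d c U₁ W₁ → SolvesPDE A d c U₂ W₁ →
      (∀ᶠ x in nhds x₀, U₁ (t₀, x) = U₂ (t₀, x)) →
      ∀ᶠ p in nhds (t₀, x₀), U₁ p = U₂ p) := by
  classical
  set S := multiIdxSet N d with hS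
  obtain ⟨a, ha⟩ := exists_represents_finset (p₀ := (t₀, x₀)) Finset.univ
    (f := fun i p => A p i) fun i _ => analyticAt_pi_iff.1 (hA _ hW₀) i
  obtain ⟨b, hb⟩ := exists_represents_finset (p₀ := (t₀, x₀)) (S ×ˢ Finset.univ)
    (f := fun q p => c q.1 p q.2) fun q hq =>
      analyticAt_pi_iff.1 (hc q.1 (Finset.mem_product.1 hq).1 _ hW₀) q.2
  have hball : ∀ s ∈ nhds (t₀, x₀), ∀ᶠ ρ : ℝ≥0 in nhdsWithin 0 (Set.Ioi 0),
      ∀ p, ‖p - (t₀, x₀)‖ < ρ → p ∈ s := fun s hs => by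
    obtain ⟨δ, hδ, hs⟩ := Metric.mem_nhds_iff.1 hs
    lift δ to ℝ≥0 using hδ.le
    filter_upwards [Ioo_mem_nhdsGT (show 0 < δ by exact_mod_cast hδ)] with ρ hρ p hp
    exact hs (mem_ball_iff_norm.2 (hp.trans (by exact_mod_cast hρ.2)))
  have hcoeff : ∀ᶠ ρ : ℝ≥0 in nhdsWithin 0 (Set.Ioi 0), 0 < ρ ∧
      (∀ i, Represents (t₀, x₀) ρ (fun p => A p i) (a i)) ∧
      ∀ β ∈ S, ∀ k, Represents (t₀, x₀) ρ (fun p => c β p k) (b (β, k)) := by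
    filter_upwards [ha, hb, self_mem_nhdsWithin] with ρ h h' hρ
    exact ⟨hρ, fun i => h i (Finset.mem_univ i), fun β hβ k => h' (β, k)
      (Finset.mem_product.2 ⟨hβ, Finset.mem_univ k⟩)⟩
  have hrep : ∀ f : ℝ × (Fin m → ℝ) → Fin N → ℂ, AnalyticAt ℝ f (t₀, x₀) →
      ∃ u : Fin N → MvPowerSeries (Option (Fin m)) ℂ,
        ∀ᶠ ρ : ℝ≥0 in nhdsWithin 0 (Set.Ioi 0),
          ∀ k, Represents (t₀, x₀) ρ (fun p => f p k) (u k) := fun f hf => by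
    obtain ⟨u, hu⟩ := exists_represents_finset Finset.univ
      (f := fun k p => f p k) fun k _ => analyticAt_pi_iff.1 hf k
    exact ⟨u, hu.mono fun ρ h k => h k (Finset.mem_univ k)⟩
  refine ⟨?_, fun U₁ U₂ W₁ hW₁ hp₁ _ hU₁ hU₂ hs₁ hs₂ h₀ => ?_⟩
  · obtain ⟨v, hv⟩ := hrep (fun p => V p.2) ((hV x₀ hx₀).fun_comp analyticAt_snd)
    obtain ⟨r, ⟨⟨hr, har, hbr⟩, hvr⟩, hWr, hr1⟩ := ((hcoeff.and hv).and
      ((hball W (hW.mem_nhds hW₀)).and (Ioo_mem_nhdsGT zero_lt_one))).exists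
    obtain ⟨u, hu, ρ, hρ, huρ⟩ := exists_picard_fixedPoint S a (fun β k => b (β, k))
      (fun k => restrict none (v k)) hr hr1.2.le (fun i => (har i).1)
      (fun β hβ k => (hbr β hβ k).1)
      (fun k => ne_top_of_le_ne_top (hvr k).1 (wnorm_restrict_le none (v k) _))
    have hres := (picard_eq_self_iff S a _ u v).1 hu
    obtain ⟨ε, hε⟩ : ∃ ε, ε = min r ρ := ⟨_, rfl⟩
    have hεr : ε ≤ r := hε ▸ min_le_left _ _
    have hε0 : (0 : ℝ) < ε := by
      rw [hε]
      exact_mod_cast lt_min hr hρ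
    let U : ℝ × (Fin m → ℝ) → Fin N → ℂ := fun p k => ev (u k) (coords m (p - (t₀, x₀)))
    have hU : ∀ k, Represents (t₀, x₀) ε (fun p => U p k) (u k) := fun k =>
      Represents.mono ⟨huρ k, fun _ _ => rfl⟩ (hε ▸ min_le_right _ _)
    have hmem : ∀ p ∈ Set.Ioo (t₀ - ε) (t₀ + ε) ×ˢ Metric.ball x₀ ε, ‖p - (t₀, x₀)‖ < ε := by
      intro p hp
      rw [← Real.ball_eq_Ioo, ball_prod_same] at hp
      exact mem_ball_iff_norm.1 hp
    refine ⟨ε, hε0, Metric.ball x₀ ε, Metric.isOpen_ball, Metric.mem_ball_self hε0,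
      fun p hp => hWr p ((hmem p hp).trans_le (by exact_mod_cast hεr)), U,
      fun p hp => analyticAt_pi_iff.2 fun k => (hU k).analyticAt (hmem p hp),
      solvesPDE_of_residual_eq_zero (fun i => (har i).mono hεr)
        (fun β hβ k => (hbr β hβ k).mono hεr) hU hmem fun k => (hres k).1, fun x hx => ?_⟩
    funext k
    have hp : ‖(t₀, x) - (t₀, x₀)‖ < ε := hmem _ ⟨by simpa using hε0, hx⟩
    have h0 : coords m ((t₀, x) - (t₀, x₀)) none = 0 := by simp
    refine ((hU k).2 _ hp).trans (Eq.trans ?_ (((hvr k).mono hεr).2 _ hp).symm)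
    rw [← ev_restrict _ h0, (hres k).2, ev_restrict _ h0]
  · obtain ⟨u₁, hu₁⟩ := hrep U₁ (hU₁ _ hp₁)
    obtain ⟨u₂, hu₂⟩ := hrep U₂ (hU₂ _ hp₁)
    have h₀' : {p : ℝ × (Fin m → ℝ) | U₁ (t₀, p.2) = U₂ (t₀, p.2)} ∈ nhds (t₀, x₀) :=
      (continuous_snd.tendsto (t₀, x₀)).eventually h₀
    obtain ⟨ρ, ⟨⟨hρ, haρ, hbρ⟩, hρ₁, hρ₂⟩, hWρ, hρ₀⟩ := ((hcoeff.and (hu₁.and hu₂)).and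
      ((hball W₁ (hW₁.mem_nhds hp₁)).and (hball _ h₀'))).exists
    have h₁ := (picard_eq_self_iff S a (fun β k => b (β, k)) u₁ u₁).2 fun k =>
      ⟨residual_eq_zero hρ haρ hbρ hρ₁ hWρ hs₁ k, rfl⟩
    have h₂ := (picard_eq_self_iff S a (fun β k => b (β, k)) u₂ u₁).2 fun k =>
      ⟨residual_eq_zero hρ haρ hbρ hρ₂ hWρ hs₂ k,
        restrict_eq_restrict hρ (hρ₂ k) (hρ₁ k) fun x hx =>
          congrFun (hρ₀ (t₀, x) (by simpa using hx)).symm k⟩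
    have h := fixedPoint_unique (picard_improves S a _ _) h₁ h₂
    filter_upwards [Metric.ball_mem_nhds (t₀, x₀) (NNReal.coe_pos.2 hρ)] with p hp
    have hp' := mem_ball_iff_norm.1 hp
    funext k
    exact ((hρ₁ k).2 p hp').trans (h ▸ ((hρ₂ k).2 p hp').symm)

end
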